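/- Let d ≥ π and let s₀ = π/(2·arctan((4 − √2)/2)). Then the global minimum of C on (1, +∞) is attained in (1, s₀]: there exists s* with 1 < s* ≤ s₀ such that C(s*) ≤ C(s) for all s > 1. -/

import Mathlib

open Real Set

theorem pi_div_two_mul_mem_Ioo {s : ℝ} (hs : 1 < s) :
    0 < π / (2 * s) ∧ π / (2 * s) < π / 2 := by
  have := pi_pos
  refine ⟨by positivity, ?_⟩
  rw [div_lt_div_iff₀ (by positivity) two_pos]
  nlinarith

theorem cos_pi_div_two_mul_pos {s : ℝ} (hs : 1 < s) : 0 < cos (π / (2 * s)) := by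
  obtain ⟨h0, h1⟩ := pi_div_two_mul_mem_Ioo hs
  exact cos_pos_of_mem_Ioo ⟨by linarith, h1⟩

theorem one_lt_mul_div_pi {d s : ℝ} (hd : π ≤ d) (hs : 1 < s) : 1 < d * s / π := by
  have := pi_pos
  rw [lt_div_iff₀ pi_pos]
  nlinarith

theorem hasDerivAt_neg_sq_mul_log_cos_add_sqrt {d s : ℝ} (hd : π ≤ d) (hs : 1 < s) :
    HasDerivAt (fun s : ℝ => -(d * s / π) ^ 2 * log (cos (π / (2 * s)))
        + (d / 2) * √((d * s / π) ^ 2 - 1))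
      (-(2 * (d * s / π) * (d / π)) * log (cos (π / (2 * s)))
        - (d / π) ^ 2 * (π / 2) * tan (π / (2 * s))
        + (d / 2) * ((d * s / π) * (d / π) / √((d * s / π) ^ 2 - 1))) s := by
  have hc := cos_pi_div_two_mul_pos hs
  have h1 := one_lt_mul_div_pi hd hs
  have hq : 0 < (d * s / π) ^ 2 - 1 := by nlinarith
  have hs0 : s ≠ 0 := by positivity
  have hlin : HasDerivAt (fun s : ℝ => d * s / π) (d / π) s := by
    simpa using ((hasDerivAt_id s).const_mul d).div_const π
  have hang : HasDerivAt (fun s : ℝ => π / (2 * s)) (-(π / (2 * s ^ 2))) s := by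
    have h := (hasDerivAt_const s π).fun_div ((hasDerivAt_id s).const_mul 2)
      (by simpa using hs0)
    refine h.congr_deriv ?_
    simp only [id]
    field_simp
    ring
  have hlog := hang.cos.log hc.ne'
  have hsq := ((hlin.fun_pow 2).sub_const 1).sqrt hq.ne'
  refine (((hlin.fun_pow 2).fun_neg.fun_mul hlog).fun_add (hsq.const_mul (d / 2))).congr_deriv ?_
  have hr : √((d * s / π) ^ 2 - 1) ≠ 0 := (sqrt_pos.2 hq).ne'
  have e1 : (d / 2) * (((2 : ℕ) : ℝ) * (d * s / π) ^ (2 - 1) * (d / π)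
      / (2 * √((d * s / π) ^ 2 - 1)))
      = (d / 2) * ((d * s / π) * (d / π) / √((d * s / π) ^ 2 - 1)) := by
    generalize √((d * s / π) ^ 2 - 1) = r at hr
    simp only [Nat.cast_ofNat, Nat.add_one_sub_one, pow_one]
    field_simp
  have e2 : -(d * s / π) ^ 2 * (-sin (π / (2 * s)) * -(π / (2 * s ^ 2)) / cos (π / (2 * s)))
      = -((d / π) ^ 2 * (π / 2) * tan (π / (2 * s))) := by
    rw [tan_eq_sin_div_cos]
    generalize cos (π / (2 * s)) = c at hc
    generalize sin (π / (2 * s)) = t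
    field_simp
  rw [e1, e2]
  norm_num
  ring

/-- On `(0, arctan ((4 - √2) / 2)]`, one has `θ (tan θ - 1) ≤ -2 log (cos θ)`. -/
theorem mul_tan_sub_one_le_neg_two_mul_log_cos {θ : ℝ} (h0 : 0 < θ)
    (h1 : θ ≤ arctan ((4 - √2) / 2)) : θ * (tan θ - 1) ≤ -(2 * log (cos θ)) := by
  have hlt : θ < π / 2 := h1.trans_lt (arctan_lt_pi_div_two _)
  have hc : 0 < cos θ := cos_pos_of_mem_Ioo ⟨by linarith, hlt⟩
  have hlog := log_le_sub_one_of_pos hc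
  by_cases h : tan θ ≤ 1
  · have := cos_le_one θ
    nlinarith
  · push Not at h
    have ht : tan θ ≤ (4 - √2) / 2 := by
      rw [← arctan_tan (by linarith) hlt] at h1
      exact arctan_strictMono.le_iff_le.1 h1
    have hθ : π / 4 ≤ θ := by
      rw [← arctan_one, ← arctan_tan (by linarith) hlt]
      exact arctan_strictMono.monotone h.le
    have hcos : cos θ ≤ √2 / 2 := by
      rw [← cos_pi_div_four]
      exact cos_le_cos_of_nonneg_of_le_pi (by positivity) (by linarith) hθ
    have hpi := pi_le_four
    nlinarith

theorem monotoneOn_neg_sq_mul_log_cos_add_sqrt {d : ℝ} (hd : π ≤ d) {s₀ : ℝ}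
    (hs₀ : 1 < s₀) (h : π / (2 * s₀) ≤ arctan ((4 - √2) / 2)) :
    MonotoneOn (fun s : ℝ => -(d * s / π) ^ 2 * log (cos (π / (2 * s)))
        + (d / 2) * √((d * s / π) ^ 2 - 1)) (Ici s₀) := by
  have hder : ∀ s ∈ Ici s₀, _ := fun s (hs : s₀ ≤ s) =>
    hasDerivAt_neg_sq_mul_log_cos_add_sqrt hd (hs₀.trans_le hs)
  refine monotoneOn_of_hasDerivWithinAt_nonneg (convex_Ici s₀)
    (fun s hs => (hder s hs).continuousAt.continuousWithinAt)
    (fun s hs => (hder s (interior_subset hs)).hasDerivWithinAt) fun s hs => ?_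
  have hs' : s₀ ≤ s := interior_subset hs
  have hs1 := hs₀.trans_le hs'
  have hpi := pi_pos
  have hd0 : 0 < d := hpi.trans_le hd
  have hle : π / (2 * s) ≤ arctan ((4 - √2) / 2) :=
    le_trans (by gcongr) h
  have hkey := mul_tan_sub_one_le_neg_two_mul_log_cos (pi_div_two_mul_mem_Ioo hs1).1 hle
  have h1 := one_lt_mul_div_pi hd hs1
  have hq : 0 < (d * s / π) ^ 2 - 1 := by nlinarith
  have hsq : √((d * s / π) ^ 2 - 1) ≤ d * s / π := sqrt_le_iff.2 ⟨by linarith, by linarith⟩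
  have hroot : d / π ≤ (d * s / π) * (d / π) / √((d * s / π) ^ 2 - 1) := by
    rw [le_div_iff₀ (sqrt_pos.2 hq), mul_comm]
    gcongr
  have hlast := mul_le_mul_of_nonneg_left hroot (half_pos hd0).le
  have hmul := mul_le_mul_of_nonneg_left hkey (show 0 ≤ (d / π) ^ 2 * s by positivity)
  have e1 : (d / π) ^ 2 * s * (π / (2 * s) * (tan (π / (2 * s)) - 1))
      = (d / π) ^ 2 * (π / 2) * tan (π / (2 * s)) - d / 2 * (d / π) := by
    generalize tan (π / (2 * s)) = t
    field_simp
  have e2 : (d / π) ^ 2 * s * -(2 * log (cos (π / (2 * s))))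
      = -(2 * (d * s / π) * (d / π)) * log (cos (π / (2 * s))) := by ring
  rw [e1, e2] at hmul
  linarith

theorem tendsto_log_cos_pi_div_two_mul :
    Filter.Tendsto (fun s : ℝ => log (cos (π / (2 * s)))) (nhdsWithin 1 (Ioi 1))
      Filter.atBot := by
  refine tendsto_log_nhdsGT_zero.comp (tendsto_nhdsWithin_iff.2 ⟨?_, ?_⟩)
  · have : ContinuousAt (fun s : ℝ => cos (π / (2 * s))) 1 :=
      continuous_cos.continuousAt.comp
        (continuousAt_const.div (continuousAt_const.mul continuousAt_id) (by norm_num))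
    have h := this.tendsto.mono_left (nhdsWithin_le_nhds (s := Ioi 1))
    simpa using h
  · filter_upwards [self_mem_nhdsWithin] with s hs using cos_pi_div_two_mul_pos hs

/-- For d ≥ π, the global minimum of C on (1, ∞) is attained in (1, s₀],
where s₀ = π/(2 arctan ((4 − √2)/2)). -/
theorem C_min_in_Ioc_one_s_zero (d : ℝ) (hd : π ≤ d) :
    let C : ℝ → ℝ := fun s =>
      -(d * s / π) ^ 2 * Real.log (Real.cos (π / (2 * s)))
        + (d / 2) * Real.sqrt ((d * s / π) ^ 2 - 1)
    let s₀ : ℝ := π / (2 * Real.arctan ((4 - Real.sqrt 2) / 2))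
    ∃ sstar : ℝ, 1 < sstar ∧ sstar ≤ s₀ ∧ ∀ s : ℝ, 1 < s → C sstar ≤ C s := by
  intro C s₀
  have hpi := pi_pos
  have hd0 : 0 < d := hpi.trans_le hd
  have harc : 0 < arctan ((4 - √2) / 2) := by
    rw [arctan_pos]
    have : √2 ≤ 2 := sqrt_le_iff.2 ⟨by norm_num, by norm_num⟩
    linarith
  have hs₀ : 1 < s₀ := by
    rw [one_lt_div (by positivity)]
    linarith [arctan_lt_pi_div_two ((4 - √2) / 2)]
  have hmono : MonotoneOn C (Ici s₀) := by
    refine monotoneOn_neg_sq_mul_log_cos_add_sqrt hd hs₀ (le_of_eq ?_)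
    simp only [s₀]
    field_simp
  have hev : ∀ᶠ s in nhdsWithin 1 (Ioi 1), C s₀ ≤ C s := by
    filter_upwards [tendsto_log_cos_pi_div_two_mul.eventually_le_atBot (-C s₀),
      self_mem_nhdsWithin] with s hs hs1
    have h1 := one_lt_mul_div_pi hd hs1
    have hlog := log_nonpos (cos_pi_div_two_mul_pos hs1).le (cos_le_one _)
    have hr : 0 ≤ d / 2 * √((d * s / π) ^ 2 - 1) := by positivity
    have hq : 1 ≤ (d * s / π) ^ 2 := by nlinarith
    change C s₀ ≤ -(d * s / π) ^ 2 * log (cos (π / (2 * s))) + d / 2 * √((d * s / π) ^ 2 - 1)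
    nlinarith
  obtain ⟨u, hu, hnear⟩ := mem_nhdsGT_iff_exists_Ioo_subset.1 hev
  have hm : 1 < min u s₀ := lt_min hu hs₀
  have hcont : ContinuousOn C (Icc (min u s₀) s₀) := fun s hs =>
    (hasDerivAt_neg_sq_mul_log_cos_add_sqrt hd
      (hm.trans_le hs.1)).continuousAt.continuousWithinAt
  obtain ⟨t, ht, hmin⟩ := isCompact_Icc.exists_isMinOn ⟨s₀, min_le_right _ _, le_rfl⟩ hcont
  have hts₀ : C t ≤ C s₀ := hmin ⟨min_le_right _ _, le_rfl⟩
  refine ⟨t, hm.trans_le ht.1, ht.2, fun s hs => ?_⟩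
  rcases le_total s₀ s with h | h
  · exact hts₀.trans (hmono self_mem_Ici h h)
  rcases lt_or_ge s (min u s₀) with h' | h'
  · exact hts₀.trans (hnear ⟨hs, h'.trans_le (min_le_left _ _)⟩)
  · exact hmin ⟨h', h⟩
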